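/- arXiv:1012.1412 — 2 statements merged into one kernel-verified Lean document; each statement's English description precedes it below -/
import Mathlib

section
/- Set f(x,t) = e^{r(T−t)} h(x). Then for any 0 ≤ t₀ < t₁ ≤ T, almost surely E[ f(S(t₁), t₁) | 𝓕_{t₀} ] > f(S(t₀), t₀). -/
open MeasureTheory ProbabilityTheory Set Filter

/-- A convex function on the positive half-line has a supporting line at every point. -/
lemma ConvexOn.exists_supporting_line_Ioi {h : ℝ → ℝ} (hh : ConvexOn ℝ (Ioi 0) h)
    {p : ℝ} (hp : 0 < p) : ∃ c : ℝ, ∀ y ∈ Ioi (0 : ℝ), h p + c * (y - p) ≤ h y := by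
  have hpi : p ∈ interior (Ioi (0 : ℝ)) := by rwa [interior_Ioi]
  refine ⟨derivWithin h (Ioi p) p, fun y hy => ?_⟩
  rcases lt_trichotomy p y with hpy | rfl | hpy
  · have := hh.rightDeriv_le_slope_of_mem_interior hpi hy hpy
    rw [slope_def_field, le_div_iff₀ (by linarith)] at this
    linarith
  · simp
  · have := (hh.slope_le_leftDeriv_of_mem_interior hy hpi hpy).trans
      (hh.leftDeriv_le_rightDeriv_of_mem_interior hpi)
    rw [slope_def_field, div_le_iff₀ (by linarith)] at this
    linarith

/-- Strict Jensen inequality for a non-affine convex function on the positive half-line,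
against a measure of full support. -/
lemma ConvexOn.map_integral_lt_of_not_affine {X : Type*} [TopologicalSpace X] [MeasurableSpace X]
    [OpensMeasurableSpace X]
    {μ : Measure X} [IsProbabilityMeasure μ] [μ.IsOpenPosMeasure] {h : ℝ → ℝ} {φ : X → ℝ}
    (hh : ConvexOn ℝ (Ioi 0) h)
    (hna : ¬ ∃ a b : ℝ, ∀ x ∈ Ioi (0 : ℝ), h x = a * x + b)
    (hφ : Continuous φ) (hφ_range : range φ = Ioi 0) (hφ_int : Integrable φ μ)
    (hφ_pos : 0 < ∫ x, φ x ∂μ) (hhφ_int : Integrable (fun x => h (φ x)) μ) :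
    h (∫ x, φ x ∂μ) < ∫ x, h (φ x) ∂μ := by
  set p := ∫ x, φ x ∂μ
  obtain ⟨c, hc⟩ := hh.exists_supporting_line_Ioi hφ_pos
  have hmem (x : X) : φ x ∈ Ioi (0 : ℝ) := hφ_range ▸ mem_range_self x
  obtain ⟨y, hy, hne⟩ : ∃ y ∈ Ioi (0 : ℝ), h y ≠ h p + c * (y - p) := by
    by_contra! H
    exact hna ⟨c, h p - c * p, fun x hx => by rw [H x hx]; ring⟩
  obtain ⟨x, rfl⟩ : y ∈ range φ := hφ_range ▸ hy
  have hline_int : Integrable (fun x => h p + c * (φ x - p)) μ :=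
    (integrable_const _).add ((hφ_int.sub (integrable_const _)).const_mul _)
  have hline : ∫ x, (h p + c * (φ x - p)) ∂μ = h p := by
    rw [integral_add (f := fun _ => h p) (g := fun x => c * (φ x - p)) (integrable_const _)
      ((hφ_int.sub (integrable_const _)).const_mul _),
      integral_const_mul, integral_sub hφ_int (integrable_const _)]
    simp [p]
  have hcont : Continuous fun x => h (φ x) :=
    (hh.continuousOn isOpen_Ioi).comp_continuous hφ hmem
  have hpos : 0 < ∫ x, (h (φ x) - (h p + c * (φ x - p))) ∂μ :=
    integral_pos_of_integrable_nonneg_nonzero (x := x)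
      (hcont.sub (by fun_prop)) (hhφ_int.sub hline_int)
      (fun x => sub_nonneg.2 (hc _ (hmem x))) (sub_ne_zero.2 hne)
  rw [integral_sub hhφ_int hline_int, hline] at hpos
  linarith

/-- Freezing lemma: if `X` and `Y` are independent, then `E[F(X, Y) | X]` is obtained by
integrating out `Y`. -/
lemma ProbabilityTheory.IndepFun.condExp_prod_ae_eq_integral {Ω E E' : Type*}
    {mΩ : MeasurableSpace Ω} {mE : MeasurableSpace E} [MeasurableSpace E'] [StandardBorelSpace E']
    [Nonempty E'] {P : Measure Ω} [IsFiniteMeasure P] {X : Ω → E} {Y : Ω → E'}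
    {F : E × E' → ℝ} (hind : IndepFun X Y P) (hX : Measurable X) (hY : Measurable Y)
    (hF : Measurable F) (hint : Integrable (fun ω => F (X ω, Y ω)) P) :
    P[fun ω => F (X ω, Y ω) | mE.comap X] =ᵐ[P] fun ω => ∫ y, F (X ω, y) ∂(P.map Y) := by
  have hlaw := hind.map_prod_eq_prod_map_map hX.aemeasurable hY.aemeasurable
  rw [← Measure.compProd_const] at hlaw
  filter_upwards [condExp_prod_ae_eq_integral_condDistrib hX hY.aemeasurable
      hF.stronglyMeasurable hint,
    ae_of_ae_map hX.aemeasurable (condDistrib_ae_eq_of_measure_eq_compProd X hY.aemeasurable hlaw)]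
    with ω h1 h2
  rw [h1, h2, Kernel.const_apply]

/-- Freezing lemma for a sub-σ-algebra: if `X` is `m`-measurable and `Y` is independent of `m`,
then `E[F(X, Y) | m]` is obtained by integrating out `Y`. -/
lemma ProbabilityTheory.Indep.condExp_prod_ae_eq_integral {Ω E E' : Type*}
    {m mΩ : MeasurableSpace Ω} [MeasurableSpace E] [MeasurableSpace E'] [StandardBorelSpace E']
    [Nonempty E'] {P : Measure Ω} [IsFiniteMeasure P] {X : Ω → E} {Y : Ω → E'}
    {F : E × E' → ℝ} (hind : Indep (MeasurableSpace.comap Y inferInstance) m P) (hm : m ≤ mΩ)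
    (hX : Measurable[m] X) (hY : Measurable Y)
    (hF : Measurable F) (hint : Integrable (fun ω => F (X ω, Y ω)) P) :
    P[fun ω => F (X ω, Y ω) | m] =ᵐ[P] fun ω => ∫ y, F (X ω, y) ∂(P.map Y) := by
  have hid : @IndepFun Ω E' Ω mΩ inferInstance m Y id P := by
    refine (IndepFun_iff_Indep (mγ := m) Y id P).2 ?_
    rwa [MeasurableSpace.comap_id]
  have hFm : Measurable[m.prod inferInstance] fun q : Ω × E' => F (X q.1, q.2) :=
    hF.comp ((hX.comp measurable_fst).prodMk measurable_snd)
  have key := IndepFun.condExp_prod_ae_eq_integral (mE := m) hid.symm (measurable_id'' hm) hY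
    hFm hint
  rwa [MeasurableSpace.comap_id] at key

/-- for `f(x,t) = e^{r(T-t)} h(x)` with `h` convex, non-affine and of
linear growth, satisfying (i) `α ↦ α⁻¹ h(αx)` non-decreasing on `(0,1]` or (ii) `r = 0`,
for any `0 ≤ t₀ < t₁ ≤ T` one has a.s. `E[f(S(t₁),t₁) | 𝓕_{t₀}] > f(S(t₀),t₀)`. -/
theorem stmt_9
    {Ω : Type} [m0 : MeasurableSpace Ω] (P : Measure Ω) [IsProbabilityMeasure P]
    (ℱ : Filtration ℝ m0) (T : ℝ) (hT : 0 < T)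
    (W : ℝ → Ω → ℝ)
    (hWcont : ∀ ω, Continuous fun t => W t ω)
    (hW0 : ∀ᵐ ω ∂P, W 0 ω = 0)
    (hWadapted : Adapted ℱ W)
    (hWindep : ∀ s t : ℝ, 0 ≤ s → s ≤ t → t ≤ T →
      Indep (MeasurableSpace.comap (fun ω => W t ω - W s ω) inferInstance) (ℱ s) P)
    (hWgauss : ∀ s t : ℝ, 0 ≤ s → s ≤ t → t ≤ T →
      Measure.map (fun ω => W t ω - W s ω) P = gaussianReal 0 (Real.toNNReal (t - s)))
    (S₀ σ r : ℝ) (hS₀ : 0 < S₀) (hσ : 0 < σ) (hr : 0 ≤ r)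
    (S : ℝ → Ω → ℝ)
    (hS : ∀ t ω, S t ω = S₀ * Real.exp (σ * W t ω + (r - σ ^ 2 / 2) * t))
    (h : ℝ → ℝ)
    (hh_nonneg : ∀ x ∈ Ioi (0:ℝ), 0 ≤ h x)
    (hh_convex : ConvexOn ℝ (Ioi 0) h)
    (hh_nonaffine : ¬ ∃ a b : ℝ, ∀ x ∈ Ioi (0:ℝ), h x = a * x + b)
    (C : ℝ) (hh_growth : ∀ x ∈ Ioi (0:ℝ), h x ≤ C * (1 + x))
    (hi_or_ii :
      (∀ x ∈ Ioi (0:ℝ), MonotoneOn (fun α : ℝ => α⁻¹ * h (α * x)) (Ioc (0:ℝ) 1)) ∨ r = 0)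
    (f : ℝ → ℝ → ℝ)
    (hf : ∀ x t : ℝ, f x t = Real.exp (r * (T - t)) * h x) :
    ∀ t₀ t₁ : ℝ, 0 ≤ t₀ → t₀ < t₁ → t₁ ≤ T →
      ∀ᵐ ω ∂P, f (S t₀ ω) t₀ < (P[fun ω' => f (S t₁ ω') t₁ | ℱ t₀]) ω := by
  intro t₀ t₁ h0 h01 h1T
  have hΔ : 0 < t₁ - t₀ := sub_pos.2 h01
  have hWm (t : ℝ) : Measurable (W t) := (hWadapted t).mono (ℱ.le t) le_rfl
  have hcont : ContinuousOn h (Ioi 0) := hh_convex.continuousOn isOpen_Ioi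
  have growth_integrable {Ω' : Type} [MeasurableSpace Ω'] {μ : Measure Ω'}
      [IsProbabilityMeasure μ] {φ : Ω' → ℝ} (hφ_pos : ∀ x, 0 < φ x) (hφ : Integrable φ μ)
      (hm : AEStronglyMeasurable (fun x => h (φ x)) μ) : Integrable (fun x => h (φ x)) μ := by
    refine Integrable.mono' (((integrable_const (1 : ℝ)).add hφ).const_mul C) hm
      (Eventually.of_forall fun x => ?_)
    rw [Real.norm_of_nonneg (hh_nonneg _ (hφ_pos x))]
    exact hh_growth _ (hφ_pos x)
  have hSpos (t : ℝ) (ω : Ω) : 0 < S t ω := by rw [hS]; positivity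
  have hSm (t : ℝ) : Measurable[ℱ t] (S t) := by
    have hW' : Measurable[ℱ t] (W t) := hWadapted t
    rw [funext (hS t)]
    fun_prop
  have hSstep (ω : Ω) : S t₁ ω =
      S t₀ ω * Real.exp (σ * (W t₁ ω - W t₀ ω) + (r - σ ^ 2 / 2) * (t₁ - t₀)) := by
    rw [hS, hS, mul_assoc, ← Real.exp_add]
    ring_nf
  have hSint : Integrable (S t₁) P := by
    have h1 : Integrable (fun ω => Real.exp (σ * (W t₁ ω - W 0 ω))) P := by
      have := integrable_exp_mul_gaussianReal (μ := 0) (v := Real.toNNReal (t₁ - 0)) σ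
      rw [← hWgauss 0 t₁ le_rfl (h0.trans h01.le) h1T] at this
      exact this.comp_measurable ((hWm _).sub (hWm _))
    refine (h1.const_mul (S₀ * Real.exp ((r - σ ^ 2 / 2) * t₁))).congr ?_
    filter_upwards [hW0] with ω hω
    rw [hS, hω, sub_zero, Real.exp_add]
    ring
  have hG : Measurable fun q : {x : ℝ // 0 < x} × ℝ =>
      f (q.1 * Real.exp (σ * q.2 + (r - σ ^ 2 / 2) * (t₁ - t₀))) t₁ := by
    simp_rw [hf]
    refine Measurable.const_mul (Continuous.measurable ?_) _
    exact hcont.comp_continuous (by fun_prop) fun q => mul_pos q.1.2 (Real.exp_pos _)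
  have hhSm : Measurable fun ω => h (S t₁ ω) := by
    have : Continuous fun x : {x : ℝ // 0 < x} => h x :=
      hcont.comp_continuous continuous_subtype_val fun x => x.2
    exact this.measurable.comp (((hSm t₁).mono (ℱ.le t₁) le_rfl).subtype_mk (h := hSpos t₁))
  have hfSint : Integrable (fun ω => f (S t₁ ω) t₁) P := by
    simp_rw [hf]
    exact (growth_integrable (hSpos t₁) hSint hhSm.aestronglyMeasurable).const_mul _
  have hfreeze := (hWindep t₀ t₁ h0 h01.le h1T).condExp_prod_ae_eq_integral (ℱ.le t₀)
    (X := fun ω => (⟨S t₀ ω, hSpos t₀ ω⟩ : {x : ℝ // 0 < x})) (Y := fun ω => W t₁ ω - W t₀ ω)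
    ((hSm t₀).subtype_mk) ((hWm _).sub (hWm _)) hG
    (by simpa only [← hSstep] using hfSint)
  simp only [← hSstep] at hfreeze
  rw [hWgauss t₀ t₁ h0 h01.le h1T] at hfreeze
  filter_upwards [hfreeze] with ω hω
  rw [hω]
  generalize S t₀ ω = x, hSpos t₀ ω = hx
  clear hω hfreeze
  have hv : Real.toNNReal (t₁ - t₀) ≠ 0 := (Real.toNNReal_pos.2 hΔ).ne'
  have : (gaussianReal 0 (Real.toNNReal (t₁ - t₀))).IsOpenPosMeasure :=
    (gaussianReal_absolutelyContinuous' 0 hv).isOpenPosMeasure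
  set φ : ℝ → ℝ := fun y => x * Real.exp (σ * y + (r - σ ^ 2 / 2) * (t₁ - t₀)) with hφ
  have hφ_eq : φ = fun y => x * Real.exp ((r - σ ^ 2 / 2) * (t₁ - t₀)) * Real.exp (σ * y) := by
    ext y
    rw [hφ, mul_assoc, ← Real.exp_add, add_comm]
  have hφ_pos (y : ℝ) : 0 < φ y := mul_pos hx (Real.exp_pos _)
  have hφ_cont : Continuous φ := by fun_prop
  have hφ_range : range φ = Ioi 0 := by
    refine Subset.antisymm (range_subset_iff.2 hφ_pos) fun y (hy : 0 < y) =>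
      ⟨(Real.log (y / x) - (r - σ ^ 2 / 2) * (t₁ - t₀)) / σ, ?_⟩
    simp only [hφ]
    rw [mul_div_cancel₀ _ hσ.ne', sub_add_cancel, Real.exp_log (div_pos hy hx),
      mul_div_cancel₀ _ hx.ne']
  have hφ_int : Integrable φ (gaussianReal 0 (Real.toNNReal (t₁ - t₀))) := by
    rw [hφ_eq]
    exact (integrable_exp_mul_gaussianReal σ).const_mul _
  have hφ_mean : ∫ y, φ y ∂(gaussianReal 0 (Real.toNNReal (t₁ - t₀)))
      = x * Real.exp (r * (t₁ - t₀)) := by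
    have hmgf := congrFun (mgf_fun_id_gaussianReal (μ := 0) (v := Real.toNNReal (t₁ - t₀))) σ
    rw [mgf, Real.coe_toNNReal _ hΔ.le] at hmgf
    rw [hφ_eq, integral_const_mul, hmgf, mul_assoc, ← Real.exp_add]
    ring_nf
  have hmean_pos : 0 < x * Real.exp (r * (t₁ - t₀)) := by positivity
  have hhφ_int := growth_integrable hφ_pos hφ_int
    (hcont.comp_continuous hφ_cont hφ_pos).aestronglyMeasurable
  have hjensen := hh_convex.map_integral_lt_of_not_affine hh_nonaffine hφ_cont hφ_range hφ_int
    (by rwa [hφ_mean]) hhφ_int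
  rw [hφ_mean] at hjensen
  have hscale : Real.exp (r * (t₁ - t₀)) * h x ≤ h (x * Real.exp (r * (t₁ - t₀))) := by
    rcases hi_or_ii with hi | rfl
    · have hle : Real.exp (-(r * (t₁ - t₀))) ≤ 1 :=
        Real.exp_le_one_iff.2 (neg_nonpos.2 (mul_nonneg hr hΔ.le))
      have := hi _ hmean_pos ⟨Real.exp_pos _, hle⟩ ⟨one_pos, le_rfl⟩ hle
      simp only [← Real.exp_neg, neg_neg, inv_one, one_mul] at this
      rwa [mul_left_comm, ← Real.exp_add, neg_add_cancel, Real.exp_zero, mul_one] at this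
    · simp
  simp_rw [hf]
  rw [integral_const_mul]
  calc Real.exp (r * (T - t₀)) * h x
      = Real.exp (r * (T - t₁)) * (Real.exp (r * (t₁ - t₀)) * h x) := by
        rw [← mul_assoc, ← Real.exp_add]
        ring_nf
    _ < _ := by
        gcongr
        exact hscale.trans_lt hjensen
end

section
/- There exists an optimal control for the linear-payoff problem with cumulative constraint ∫₀ᵀ u dt ≤ 1: some ū ∈ 𝒰' satisfies E[∫₀ᵀ ū(t) f(S(t),t) dt] = sup_{u ∈ 𝒰'} E[∫₀ᵀ u(t) f(S(t),t) dt]. -/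
open MeasureTheory ProbabilityTheory Set Filter

/-- A decreasing sequence of nonempty bounded closed convex sets in a Hilbert space has a
common point. -/
theorem nonempty_iInter_of_antitone_convex_bounded {E : Type*} [NormedAddCommGroup E]
    [InnerProductSpace ℝ E] [CompleteSpace E] {K : ℕ → Set E} (hanti : Antitone K)
    (hne : ∀ n, (K n).Nonempty) (hclosed : ∀ n, IsClosed (K n)) (hconv : ∀ n, Convex ℝ (K n))
    (hbdd : Bornology.IsBounded (K 0)) : (⋂ n, K n).Nonempty := by
  choose x hxK hx using fun n =>
    exists_norm_eq_iInf_of_complete_convex (hne n) (hclosed n).isComplete (hconv n) 0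
  have hmin : ∀ n, ∀ w ∈ K n, ‖x n‖ ≤ ‖w‖ := by
    intro n w hw
    have h := hx n
    simp only [zero_sub, norm_neg] at h
    rw [h]
    exact ciInf_le ⟨0, forall_mem_range.2 fun _ => norm_nonneg _⟩ (⟨w, hw⟩ : K n)
  have hmono : Monotone fun n => ‖x n‖ ^ 2 := fun n k hnk =>
    pow_le_pow_left₀ (norm_nonneg _) (hmin n _ (hanti hnk (hxK k))) 2
  obtain ⟨R, hR⟩ := hbdd.exists_norm_le
  have hbddAbove : BddAbove (range fun n => ‖x n‖ ^ 2) :=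
    ⟨R ^ 2, forall_mem_range.2 fun n =>
      pow_le_pow_left₀ (norm_nonneg _) (hR _ (hanti (Nat.zero_le n) (hxK n))) 2⟩
  set a := ⨆ n, ‖x n‖ ^ 2
  have hcauchy : CauchySeq x := by
    refine Metric.cauchySeq_iff'.2 fun ε hε => ?_
    obtain ⟨N, hN⟩ := exists_lt_of_lt_ciSup (show a - ε ^ 2 / 2 < a by
      have := sq_pos_of_pos hε; linarith)
    refine ⟨N, fun n hn => ?_⟩
    have hmid : (1 / 2 : ℝ) • x n + (1 / 2 : ℝ) • x N ∈ K N :=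
      hconv N (hanti hn (hxK n)) (hxK N) (by norm_num) (by norm_num) (by norm_num)
    have h1 := hmin N _ hmid
    rw [← smul_add, norm_smul] at h1
    norm_num at h1
    have h2 := parallelogram_law_with_norm ℝ (x n) (x N)
    have h3 : ‖x n‖ ^ 2 ≤ a := le_ciSup hbddAbove n
    rw [dist_eq_norm]
    refine lt_of_pow_lt_pow_left₀ 2 hε.le ?_
    nlinarith [norm_nonneg (x N)]
  obtain ⟨y, hy⟩ := cauchySeq_tendsto_of_complete hcauchy
  refine ⟨y, mem_iInter.2 fun n => (hclosed n).mem_of_tendsto hy ?_⟩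
  filter_upwards [eventually_ge_atTop n] with k hk using hanti hk (hxK k)

/-- A continuous linear functional attains its maximum on a nonempty bounded closed convex
subset of a Hilbert space. -/
theorem exists_isMaxOn_of_convex_bounded {E : Type*} [NormedAddCommGroup E]
    [InnerProductSpace ℝ E] [CompleteSpace E] {K : Set E} (hne : K.Nonempty)
    (hclosed : IsClosed K) (hconv : Convex ℝ K) (hbdd : Bornology.IsBounded K)
    (ℓ : E →L[ℝ] ℝ) : ∃ x ∈ K, IsMaxOn ℓ K x := by
  have hbddAbove : BddAbove (ℓ '' K) := (ℓ.lipschitz.isBounded_image hbdd).bddAbove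
  have key := nonempty_iInter_of_antitone_convex_bounded
    (K := fun n : ℕ => K ∩ ℓ ⁻¹' Ici (sSup (ℓ '' K) - 1 / ((n : ℝ) + 1)))
    (fun n k hnk => by
      refine inter_subset_inter_right _ (preimage_mono (Ici_subset_Ici.2 ?_))
      have := Nat.one_div_le_one_div (α := ℝ) hnk
      linarith)
    (fun n => by
      obtain ⟨_, ⟨w, hw, rfl⟩, hlt⟩ := exists_lt_of_lt_csSup (hne.image ℓ)
        (sub_lt_self (sSup (ℓ '' K)) (Nat.one_div_pos_of_nat (α := ℝ) (n := n)))
      exact ⟨w, hw, hlt.le⟩)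
    (fun n => hclosed.inter (isClosed_Ici.preimage ℓ.continuous))
    (fun n => hconv.inter ((convex_Ici _).linear_preimage ℓ.toLinearMap))
    (hbdd.subset inter_subset_left)
  obtain ⟨y, hy⟩ := key
  rw [mem_iInter] at hy
  refine ⟨y, (hy 0).1, fun z hz => (le_csSup hbddAbove (mem_image_of_mem ℓ hz)).trans ?_⟩
  refine le_of_forall_pos_le_add fun ε hε => ?_
  obtain ⟨n, hn⟩ := exists_nat_one_div_lt hε
  have := (hy n).2
  rw [mem_preimage, mem_Ici] at this
  linarith

/-- The progressive σ-algebra of a filtration indexed by `ℝ`. -/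
@[reducible]
def progressiveSigmaAlgebra {Ω : Type*} {m0 : MeasurableSpace Ω} (ℱ : Filtration ℝ m0) :
    MeasurableSpace (ℝ × Ω) :=
  ⨅ i, MeasurableSpace.map (fun p : Iic i × Ω => (p.1.1, p.2))
    (Subtype.instMeasurableSpace.prod (ℱ i))

theorem isStronglyProgressive_iff_measurable_uncurry {Ω : Type*} {m0 : MeasurableSpace Ω}
    {ℱ : Filtration ℝ m0} {u : ℝ → Ω → ℝ} :
    IsStronglyProgressive ℱ u ↔ Measurable[progressiveSigmaAlgebra ℱ] (Function.uncurry u) := by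
  constructor
  · intro h s hs
    exact MeasurableSpace.measurableSet_iInf.2 fun i => (h i).measurable hs
  · intro h i
    refine Measurable.stronglyMeasurable fun s hs => ?_
    exact MeasurableSpace.measurableSet_iInf.1 (h hs) i

theorem progressiveSigmaAlgebra_le {Ω : Type*} {m0 : MeasurableSpace Ω}
    (ℱ : Filtration ℝ m0) : progressiveSigmaAlgebra ℱ ≤ Prod.instMeasurableSpace := by
  intro A hA
  have hA' : A = ⋃ n : ℕ, (fun p : Iic (n : ℝ) × Ω => (p.1.1, p.2)) ''
      ((fun p : Iic (n : ℝ) × Ω => (p.1.1, p.2)) ⁻¹' A) := by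
    refine Subset.antisymm (fun p hp => ?_) (iUnion_subset fun n => image_preimage_subset _ _)
    obtain ⟨n, hn⟩ := exists_nat_ge p.1
    exact mem_iUnion.2 ⟨n, (⟨p.1, hn⟩, p.2), hp, rfl⟩
  rw [hA']
  refine MeasurableSet.iUnion fun n => ?_
  have hemb : MeasurableEmbedding (fun p : Iic (n : ℝ) × Ω => (p.1.1, p.2)) :=
    (MeasurableEmbedding.subtype_coe measurableSet_Iic).prodMap MeasurableEmbedding.id
  refine hemb.measurableSet_image.2 ?_
  have hle : (Subtype.instMeasurableSpace.prod (ℱ (n : ℝ)) : MeasurableSpace (Iic (n : ℝ) × Ω)) ≤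
      Prod.instMeasurableSpace := sup_le_sup le_rfl (MeasurableSpace.comap_mono (ℱ.le n))
  exact hle _ (MeasurableSpace.measurableSet_iInf.1 hA n)

/-- Bounds on a function in terms of its set integrals. -/
theorem ae_mem_Icc_iff_setIntegral {α : Type*} [MeasurableSpace α] {μ : Measure α}
    [IsFiniteMeasure μ] {x : α → ℝ} (hx : Integrable x μ) (L : ℝ) :
    (∀ᵐ p ∂μ, x p ∈ Icc 0 L) ↔
      ∀ B, MeasurableSet B → ∫ p in B, x p ∂μ ∈ Icc 0 (L * μ.real B) := by
  have hconst : ∀ B, ∫ _ in B, L ∂μ = L * μ.real B := fun B => by simp [mul_comm]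
  constructor
  · intro h B hB
    refine ⟨integral_nonneg_of_ae (ae_restrict_of_ae (h.mono fun p hp => hp.1)), ?_⟩
    rw [← hconst]
    exact integral_mono_ae hx.integrableOn (integrable_const L)
      (ae_restrict_of_ae (h.mono fun p hp => hp.2))
  · intro h
    have h0 := ae_nonneg_of_forall_setIntegral_nonneg hx fun s hs _ => (h s hs).1
    have h1 := ae_le_of_forall_setIntegral_le hx (integrable_const L) fun s hs _ => by
      rw [hconst]; exact (h s hs).2
    filter_upwards [h0, h1] with p hp0 hp1 using ⟨hp0, hp1⟩

/-- An upper bound on the sections' integrals in terms of integrals over cylinders. -/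
theorem ae_integral_section_le_iff {α Ω : Type*} [MeasurableSpace α] [MeasurableSpace Ω]
    {ν : Measure α} [IsFiniteMeasure ν] {P : Measure Ω} [IsFiniteMeasure P] {x : α × Ω → ℝ}
    (hx : Integrable x (ν.prod P)) (c : ℝ) :
    (∀ᵐ ω ∂P, ∫ t, x (t, ω) ∂ν ≤ c) ↔
      ∀ A, MeasurableSet A → ∫ p in univ ×ˢ A, x p ∂(ν.prod P) ≤ c * P.real A := by
  have hconst : ∀ A, ∫ _ in A, c ∂P = c * P.real A := fun A => by simp [mul_comm]
  have hprod : ∀ A : Set Ω, ∫ p in univ ×ˢ A, x p ∂(ν.prod P) =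
      ∫ ω in A, ∫ t, x (t, ω) ∂ν ∂P := by
    intro A
    rw [← Measure.prod_restrict, Measure.restrict_univ, integral_prod_symm]
    have := hx.integrableOn (s := univ ×ˢ A)
    rwa [IntegrableOn, ← Measure.prod_restrict, Measure.restrict_univ] at this
  have hint : Integrable (fun ω => ∫ t, x (t, ω) ∂ν) P := hx.integral_prod_right
  constructor
  · intro h A hA
    rw [hprod, ← hconst]
    exact integral_mono_ae hint.integrableOn (integrable_const c) (ae_restrict_of_ae h)
  · intro h
    refine ae_le_of_forall_setIntegral_le hint (integrable_const c) fun A hA _ => ?_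
    rw [hconst, ← hprod]
    exact h A hA

/-- The set of controls lying in a subspace `M` of `L²`, with values in `[0, L]` and cumulative
control at most `1`. -/
def controlSet {α Ω : Type*} [MeasurableSpace α] [MeasurableSpace Ω]
    {ν : Measure α} {P : Measure Ω} (M : Submodule ℝ (Lp ℝ 2 (ν.prod P))) (L : ℝ) :
    Set (Lp ℝ 2 (ν.prod P)) :=
  {x | x ∈ M ∧ (∀ᵐ p ∂(ν.prod P), x p ∈ Icc 0 L) ∧
    ∀ᵐ ω ∂P, ∫ t, x (t, ω) ∂ν ≤ 1}

section ControlSet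

variable {α Ω : Type*} [MeasurableSpace α] [MeasurableSpace Ω]
  {ν : Measure α} [IsFiniteMeasure ν] {P : Measure Ω} [IsFiniteMeasure P]
  {M : Submodule ℝ (Lp ℝ 2 (ν.prod P))} {L : ℝ}

theorem controlSet_eq_inter :
    controlSet M L = (M : Set (Lp ℝ 2 (ν.prod P))) ∩
      ((⋂ B : {B : Set (α × Ω) // MeasurableSet B},
        innerSL ℝ (indicatorConstLp 2 B.2 (measure_ne_top (ν.prod P) _) (1 : ℝ)) ⁻¹'
          Icc 0 (L * (ν.prod P).real B)) ∩
      ⋂ A : {A : Set Ω // MeasurableSet A},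
        innerSL ℝ (indicatorConstLp 2 (MeasurableSet.univ.prod A.2)
          (measure_ne_top (ν.prod P) _) (1 : ℝ)) ⁻¹' Iic (1 * P.real A)) := by
  ext x
  have hx : Integrable x (ν.prod P) := (Lp.memLp x).integrable (by norm_num)
  have h1 : ∀ (B : Set (α × Ω)) (hB : MeasurableSet B),
      innerSL ℝ (indicatorConstLp 2 hB (measure_ne_top (ν.prod P) _) (1 : ℝ)) x =
        ∫ p in B, x p ∂(ν.prod P) := fun B hB => by
    rw [innerSL_apply_apply, L2.inner_indicatorConstLp_one]
  simp only [controlSet, mem_ofPred_eq, ae_mem_Icc_iff_setIntegral hx,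
    ae_integral_section_le_iff hx, mem_inter_iff, mem_iInter, mem_preimage, SetLike.mem_coe,
    h1, Subtype.forall, mem_Iic]

theorem isClosed_controlSet (hM : IsClosed (M : Set (Lp ℝ 2 (ν.prod P)))) :
    IsClosed (controlSet M L) := by
  rw [controlSet_eq_inter]
  refine IsClosed.inter hM (IsClosed.inter ?_ ?_)
  · exact isClosed_iInter fun B => isClosed_Icc.preimage (ContinuousLinearMap.continuous _)
  · exact isClosed_iInter fun A => isClosed_Iic.preimage (ContinuousLinearMap.continuous _)

theorem convex_controlSet : Convex ℝ (controlSet M L) := by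
  rw [controlSet_eq_inter]
  refine (Submodule.convex _).inter (Convex.inter ?_ ?_)
  · exact convex_iInter fun B => (convex_Icc _ _).linear_preimage (ContinuousLinearMap.toLinearMap _)
  · exact convex_iInter fun A => (convex_Iic _).linear_preimage (ContinuousLinearMap.toLinearMap _)

theorem isBounded_controlSet : Bornology.IsBounded (controlSet M L) := by
  refine isBounded_iff_forall_norm_le.2
    ⟨((ν.prod P) univ).toReal ^ (2 : ENNReal).toReal⁻¹ * |L|, fun x hx => ?_⟩
  refine Lp.norm_le_of_ae_bound (abs_nonneg L) ?_
  filter_upwards [hx.2.1] with p hp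
  rw [Real.norm_eq_abs]
  exact abs_le_abs_of_nonneg hp.1 hp.2

theorem nonempty_controlSet (hL : 0 ≤ L) : (controlSet M L).Nonempty := by
  have h0 := Lp.coeFn_zero ℝ 2 (ν.prod P)
  have hint : Integrable (0 : Lp ℝ 2 (ν.prod P)) (ν.prod P) :=
    (Lp.memLp _).integrable (by norm_num)
  refine ⟨0, M.zero_mem, ?_, ?_⟩
  · filter_upwards [h0] with p hp
    rw [hp]
    exact ⟨le_rfl, hL⟩
  · refine (ae_integral_section_le_iff hint 1).2 fun A _ => ?_
    rw [integral_congr_ae (ae_restrict_of_ae h0)]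
    simp

end ControlSet

/-- Exponentials of affine functions of time and Brownian motion are jointly integrable. -/
theorem integrable_exp_brownian {Ω : Type*} [MeasurableSpace Ω] {P : Measure Ω}
    [IsProbabilityMeasure P] {T : ℝ} {W : ℝ → Ω → ℝ}
    (hW : Measurable (Function.uncurry W))
    (hWgauss : ∀ t ∈ Icc 0 T, P.map (W t) = gaussianReal 0 (Real.toNNReal t)) (a b : ℝ) :
    Integrable (fun p : ℝ × Ω => Real.exp (a * W p.1 p.2 + b * p.1))
      ((volume.restrict (Icc (0 : ℝ) T)).prod P) := by
  have hmeas : Measurable fun p : ℝ × Ω => Real.exp (a * W p.1 p.2 + b * p.1) :=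
    ((hW.const_mul a).add (measurable_fst.const_mul b)).exp
  have hsec : ∀ t ∈ Icc 0 T, Integrable (fun ω => Real.exp (a * W t ω + b * t)) P ∧
      ∫ ω, Real.exp (a * W t ω + b * t) ∂P = Real.exp (t * a ^ 2 / 2 + b * t) := by
    intro t ht
    have hmgf := mgf_gaussianReal (hWgauss t ht) a
    rw [Real.coe_toNNReal _ ht.1, zero_mul, zero_add] at hmgf
    have hint : Integrable (fun ω => Real.exp (a * W t ω)) P :=
      mgf_pos_iff.1 (by rw [hmgf]; exact Real.exp_pos _)
    simp_rw [Real.exp_add]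
    refine ⟨hint.mul_const _, ?_⟩
    rw [integral_mul_const, ← hmgf]
    rfl
  refine (integrable_prod_iff hmeas.aestronglyMeasurable).2 ⟨?_, ?_⟩
  · filter_upwards [ae_restrict_mem measurableSet_Icc] with t ht using (hsec t ht).1
  · have hcont : IntegrableOn (fun t : ℝ => Real.exp (t * a ^ 2 / 2 + b * t)) (Icc 0 T) :=
      Continuous.integrableOn_Icc (by fun_prop)
    refine hcont.congr ?_
    filter_upwards [ae_restrict_mem measurableSet_Icc] with t ht
    simp only [Real.norm_eq_abs, Real.abs_exp]
    exact (hsec t ht).2.symm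

/-- A payoff of linear growth along a geometric Brownian motion is square integrable. -/
theorem memLp_two_payoff {Ω : Type*} [MeasurableSpace Ω] {P : Measure Ω}
    [IsProbabilityMeasure P] {T : ℝ} {W : ℝ → Ω → ℝ} (hW : Measurable (Function.uncurry W))
    (hWgauss : ∀ t ∈ Icc 0 T, P.map (W t) = gaussianReal 0 (Real.toNNReal t))
    {S₀ σ b : ℝ} (hS₀ : 0 < S₀) {S : ℝ → Ω → ℝ}
    (hS : ∀ t ω, S t ω = S₀ * Real.exp (σ * W t ω + b * t)) {f : ℝ → ℝ → ℝ}
    (hf : ContinuousOn (fun p : ℝ × ℝ => f p.1 p.2) (Ioi (0 : ℝ) ×ˢ Icc (0 : ℝ) T)) {C : ℝ}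
    (hgrowth : ∀ x ∈ Ioi (0 : ℝ), ∀ t ∈ Icc (0 : ℝ) T, |f x t| ≤ C * (|x| + 1)) :
    MemLp (fun p : ℝ × Ω => f (S p.1 p.2) p.1) 2
      ((volume.restrict (Icc (0 : ℝ) T)).prod P) := by
  have hSmeas : Measurable fun p : ℝ × Ω => S p.1 p.2 := by
    simp_rw [hS]
    exact ((hW.const_mul σ).add (measurable_fst.const_mul b)).exp.const_mul S₀
  have hSpos : ∀ t ω, 0 < S t ω := fun t ω => by rw [hS]; positivity
  have hIcc : ∀ᵐ p ∂((volume.restrict (Icc (0 : ℝ) T)).prod P), p.1 ∈ Icc (0 : ℝ) T :=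
    Measure.quasiMeasurePreserving_fst.ae (ae_restrict_mem measurableSet_Icc)
  have hSL2 : MemLp (fun p : ℝ × Ω => S p.1 p.2) 2
      ((volume.restrict (Icc (0 : ℝ) T)).prod P) := by
    refine (memLp_two_iff_integrable_sq hSmeas.aestronglyMeasurable).2 ?_
    refine ((integrable_exp_brownian hW hWgauss (2 * σ) (2 * b)).const_mul
      (S₀ ^ 2)).congr (Eventually.of_forall fun p => ?_)
    simp only [hS, mul_pow, ← Real.exp_nat_mul]
    congr 2
    push_cast
    ring
  have hmeas : AEStronglyMeasurable (fun p : ℝ × Ω => f (S p.1 p.2) p.1)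
      ((volume.restrict (Icc (0 : ℝ) T)).prod P) := by
    classical
    have hpw : Measurable ((Ioi (0 : ℝ) ×ˢ Icc (0 : ℝ) T).piecewise
        (fun p : ℝ × ℝ => f p.1 p.2) 0) :=
      hf.measurable_piecewise continuousOn_const (measurableSet_Ioi.prod measurableSet_Icc)
    refine (hpw.comp (hSmeas.prodMk measurable_fst)).aestronglyMeasurable.congr ?_
    filter_upwards [hIcc] with p hp
    exact piecewise_eq_of_mem _ _ _ ⟨hSpos p.1 p.2, hp⟩
  refine ((hSL2.add (memLp_const (1 : ℝ))).const_mul C).mono hmeas ?_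
  filter_upwards [hIcc] with p hp
  have h := hgrowth _ (hSpos p.1 p.2) _ hp
  rw [abs_of_pos (hSpos p.1 p.2)] at h
  exact h.trans (le_abs_self _)

/-- existence of an optimal control for the linear-payoff problem over
the class `𝒰'` of adapted processes with values in `[0,L]` and cumulative constraint
`∫₀ᵀ u dt ≤ 1`. -/
theorem stmt_14
    {Ω : Type} [m0 : MeasurableSpace Ω] (P : Measure Ω) [IsProbabilityMeasure P]
    (ℱ : Filtration ℝ m0) (T : ℝ) (hT : 0 < T)
    (W : ℝ → Ω → ℝ)
    (hWcont : ∀ ω, Continuous fun t => W t ω)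
    (hW0 : ∀ᵐ ω ∂P, W 0 ω = 0)
    (hWadapted : Adapted ℱ W)
    (hWindep : ∀ s t : ℝ, 0 ≤ s → s ≤ t → t ≤ T →
      Indep (MeasurableSpace.comap (fun ω => W t ω - W s ω) inferInstance) (ℱ s) P)
    (hWgauss : ∀ s t : ℝ, 0 ≤ s → s ≤ t → t ≤ T →
      Measure.map (fun ω => W t ω - W s ω) P = gaussianReal 0 (Real.toNNReal (t - s)))
    (S₀ σ r : ℝ) (hS₀ : 0 < S₀) (hσ : 0 < σ) (hr : 0 ≤ r)
    (S : ℝ → Ω → ℝ)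
    (hS : ∀ t ω, S t ω = S₀ * Real.exp (σ * W t ω + (r - σ ^ 2 / 2) * t))
    (f : ℝ → ℝ → ℝ)
    (hf_cont : ContinuousOn (fun p : ℝ × ℝ => f p.1 p.2) (Ioi (0:ℝ) ×ˢ Icc (0:ℝ) T))
    (hf_nonneg : ∀ x ∈ Ioi (0:ℝ), ∀ t ∈ Icc (0:ℝ) T, 0 ≤ f x t)
    (C : ℝ)
    (hgrowth : ∀ x ∈ Ioi (0:ℝ), ∀ t ∈ Icc (0:ℝ) T, |f x t| ≤ C * (|x| + 1))
    (L : ℝ) (hL : 0 < L) :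
    ∃ ubar : ℝ → Ω → ℝ,
      (ProgMeasurable ℱ ubar ∧
        (∀ᵐ p ∂((volume.restrict (Icc (0:ℝ) T)).prod P), ubar p.1 p.2 ∈ Icc (0:ℝ) L) ∧
        (∀ᵐ ω ∂P, (∫ t in (0:ℝ)..T, ubar t ω) ≤ 1)) ∧
      IsGreatest
        {x : ℝ | ∃ u : ℝ → Ω → ℝ,
          (ProgMeasurable ℱ u ∧
            (∀ᵐ p ∂((volume.restrict (Icc (0:ℝ) T)).prod P), u p.1 p.2 ∈ Icc (0:ℝ) L) ∧
            (∀ᵐ ω ∂P, (∫ t in (0:ℝ)..T, u t ω) ≤ 1)) ∧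
          x = ∫ ω, (∫ t in (0:ℝ)..T, u t ω * f (S t ω) t) ∂P}
        (∫ ω, (∫ t in (0:ℝ)..T, ubar t ω * f (S t ω) t) ∂P) := by
  have hWmeas : Measurable (Function.uncurry W) :=
    measurable_uncurry_of_continuous_of_measurable hWcont fun t => (hWadapted t).mono (ℱ.le t) le_rfl
  have hWlaw : ∀ t ∈ Icc 0 T, P.map (W t) = gaussianReal 0 (Real.toNNReal t) := by
    intro t ht
    rw [← sub_zero t, ← hWgauss 0 t le_rfl ht.1 ht.2, sub_zero]
    refine Measure.map_congr ?_
    filter_upwards [hW0] with ω hω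
    rw [hω, sub_zero]
  have hg := memLp_two_payoff hWmeas hWlaw hS₀ hS hf_cont hgrowth
  set ν : Measure ℝ := volume.restrict (Icc (0 : ℝ) T) with hν
  have hinterval : ∀ h : ℝ → ℝ, ∫ t in (0 : ℝ)..T, h t = ∫ t, h t ∂ν := fun h => by
    rw [intervalIntegral.integral_of_le hT.le, hν, integral_Icc_eq_integral_Ioc]
  simp_rw [hinterval]
  set M : Submodule ℝ (Lp ℝ 2 (ν.prod P)) :=
    lpMeas ℝ ℝ (progressiveSigmaAlgebra ℱ) 2 (ν.prod P)
  set G : Lp ℝ 2 (ν.prod P) := hg.toLp _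
  have hpayoff : ∀ (u : ℝ → Ω → ℝ) (x : Lp ℝ 2 (ν.prod P)), x =ᵐ[ν.prod P] Function.uncurry u →
      ∫ ω, ∫ t, u t ω * f (S t ω) t ∂ν ∂P = innerSL ℝ G x := by
    intro u x hux
    have hprod : (fun p : ℝ × Ω => u p.1 p.2 * f (S p.1 p.2) p.1) =ᵐ[ν.prod P]
        fun p => inner ℝ (G p) (x p) := by
      filter_upwards [hux, hg.coeFn_toLp] with p hp hGp
      rw [hGp, hp]
      rfl
    rw [innerSL_apply_apply, L2.inner_def, ← integral_congr_ae hprod,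
      integral_prod_symm _ ((L2.integrable_inner G x).congr hprod.symm)]
  have hsection : ∀ (u : ℝ → Ω → ℝ) (x : Lp ℝ 2 (ν.prod P)), x =ᵐ[ν.prod P] Function.uncurry u →
      ∀ᵐ ω ∂P, ∫ t, x (t, ω) ∂ν = ∫ t, u t ω ∂ν := by
    intro u x hux
    have hswap : ∀ᵐ q ∂(P.prod ν), x q.swap = Function.uncurry u q.swap :=
      Measure.measurePreserving_swap.quasiMeasurePreserving.ae hux
    filter_upwards [Measure.ae_ae_of_ae_prod hswap] with ω hω using integral_congr_ae hω
  obtain ⟨x, ⟨hxM, hxIcc, hx1⟩, hmax⟩ := exists_isMaxOn_of_convex_bounded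
    (nonempty_controlSet (M := M) hL.le)
    (isClosed_controlSet (isClosed_aestronglyMeasurable (progressiveSigmaAlgebra_le ℱ)))
    convex_controlSet isBounded_controlSet (innerSL ℝ G)
  obtain ⟨v, hv, hxv⟩ := mem_lpMeas_iff_aestronglyMeasurable.1 hxM
  have hadm : IsStronglyProgressive ℱ (Function.curry v) ∧
      (∀ᵐ p ∂(ν.prod P), Function.curry v p.1 p.2 ∈ Icc (0 : ℝ) L) ∧
      ∀ᵐ ω ∂P, ∫ t, Function.curry v t ω ∂ν ≤ 1 := by
    refine ⟨isStronglyProgressive_iff_measurable_uncurry.2 hv.measurable, ?_, ?_⟩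
    · filter_upwards [hxIcc, hxv] with p hp hpv
      rw [hpv] at hp
      exact hp
    · filter_upwards [hx1, hsection (Function.curry v) x hxv] with ω hω hωv
      exact hωv ▸ hω
  refine ⟨Function.curry v, hadm, ⟨_, hadm, rfl⟩, ?_⟩
  rintro _ ⟨u, ⟨hprog, hIcc, h1⟩, rfl⟩
  have hum := isStronglyProgressive_iff_measurable_uncurry.1 hprog
  have huLp : MemLp (Function.uncurry u) 2 (ν.prod P) := by
    refine MemLp.of_bound (hum.mono (progressiveSigmaAlgebra_le ℱ) le_rfl).aestronglyMeasurable
      L ?_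
    filter_upwards [hIcc] with p hp
    exact (Real.norm_of_nonneg hp.1).trans_le hp.2
  have hu := huLp.coeFn_toLp
  have hmem : huLp.toLp _ ∈ controlSet M L := by
    refine ⟨mem_lpMeas_iff_aestronglyMeasurable.2 ⟨_, hum.stronglyMeasurable, hu⟩, ?_, ?_⟩
    · filter_upwards [hIcc, hu] with p hp hpu
      exact hpu ▸ hp
    · filter_upwards [h1, hsection u _ hu] with ω hω hωu
      exact hωu ▸ hω
  rw [hpayoff u _ hu, hpayoff (Function.curry v) x hxv]
  exact hmax hmem
end
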